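/- Let (K, v) be a valued field and {a_i}_{i∈I} a pseudo-Cauchy sequence in K indexed by a well-ordered set I with no greatest element. For i ∈ I, let γ_i be the common value v(a_j − a_i) for j > i, let ν_i = v_{a_i, γ_i}, and let 𝔳 = {ν_i}_{i∈I}. Then for a nonzero polynomial f ∈ K[x], the following are equivalent: (a) f is 𝔳-unstable and every polynomial of degree strictly smaller than deg f is 𝔳-stable; (b) f is not fixed by {a_i} and every polynomial of degree strictly smaller than deg f is fixed by {a_i}. -/

import Mathlib

open Polynomial

/-- A valuation on the field `K` with values in `Γ ∪ {∞}`. -/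
def IsValdF {K Γ : Type*} [Field K] [AddCommGroup Γ] [LinearOrder Γ] [IsOrderedAddMonoid Γ] (v : K → WithTop Γ) : Prop :=
  (∀ a b : K, v (a * b) = v a + v b) ∧ (∀ a b : K, min (v a) (v b) ≤ v (a + b)) ∧
    (∀ a : K, v a = ⊤ ↔ a = 0)

/-- The monomial valuation `v_{a,γ}` on `K[x]`:
`v_{a,γ}(c_0 + c_1(x-a) + … + c_r(x-a)^r) = min_i (v(c_i) + i·γ)`. -/
noncomputable def mval {K Γ : Type*} [Field K] [AddCommGroup Γ] [LinearOrder Γ] [IsOrderedAddMonoid Γ]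
    (v : K → WithTop Γ) (a : K) (γ : Γ) (f : Polynomial K) : WithTop Γ :=
  (Finset.range (f.natDegree + 1)).inf fun i =>
    v ((Polynomial.taylor a f).coeff i) + ((i • γ : Γ) : WithTop Γ)

/-- A polynomial `f` is fixed by the sequence `{a_i}` if the values `v(f(a_i))` are
ultimately constant. -/
def PCFixed {K Γ I : Type*} [Field K] [AddCommGroup Γ] [LinearOrder Γ] [IsOrderedAddMonoid Γ] [LinearOrder I]
    (v : K → WithTop Γ) (a : I → K) (f : Polynomial K) : Prop :=
  ∃ i₀ : I, ∀ i : I, i₀ ≤ i → v (f.eval (a i)) = v (f.eval (a i₀))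

/-- A polynomial `f` is stable for a family `{ν_i}` if the values `ν_i(f)` are
ultimately constant. -/
def FamStable {K Γ I : Type*} [Field K] [AddCommGroup Γ] [LinearOrder Γ] [IsOrderedAddMonoid Γ] [LinearOrder I]
    (ν : I → Polynomial K → WithTop Γ) (f : Polynomial K) : Prop :=
  ∃ i₀ : I, ∀ i : I, i₀ ≤ i → ν i f = ν i₀ f

open Filter in
theorem aux_min {Γ : Type*} [AddCommGroup Γ] [LinearOrder Γ] [IsOrderedAddMonoid Γ]
    {I : Type*} [LinearOrder I] [Nonempty I] (hnomax : ∀ i : I, ∃ j : I, i < j)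
    (γ : I → Γ) (hγ : StrictMono γ) (β : ℕ → WithTop Γ) (S : Finset ℕ) :
    (∀ k ∈ S, β k = ⊤) ∨ ∃ k₀ ∈ S, β k₀ ≠ ⊤ ∧ ∀ᶠ i in atTop, ∀ l ∈ S, l ≠ k₀ →
      β k₀ + ((k₀ • γ i : Γ) : WithTop Γ) < β l + ((l • γ i : Γ) : WithTop Γ) := by
  have pair : ∀ k l : ℕ, k < l → ∀ b c : Γ,
      (∀ᶠ i in atTop, b + k • γ i < c + l • γ i) ∨
      (∀ᶠ i in atTop, c + l • γ i < b + k • γ i) := by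
    intro k l hkl b c
    by_cases h : ∃ i, b + k • γ i ≤ c + l • γ i
    · left
      obtain ⟨i, hi⟩ := h
      obtain ⟨j, hj⟩ := hnomax i
      filter_upwards [eventually_ge_atTop j] with m hm
      have hlt : γ i < γ m := hγ (lt_of_lt_of_le hj hm)
      obtain ⟨d, rfl⟩ := Nat.exists_eq_add_of_lt hkl
      have e : ∀ x : Γ, (k + d + 1) • x = k • x + (d + 1) • x := by
        intro x; rw [add_assoc, add_nsmul]
      rw [e] at hi ⊢
      have h2 : (d + 1) • γ i < (d + 1) • γ m := nsmul_lt_nsmul_right (Nat.succ_ne_zero d) hlt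
      have h3 : b ≤ c + (d + 1) • γ i := by
        have : b + k • γ i ≤ (c + (d + 1) • γ i) + k • γ i := by
          calc _ ≤ _ := hi
            _ = _ := by abel
        exact le_of_add_le_add_right this
      calc b + k • γ m ≤ c + (d + 1) • γ i + k • γ m := by gcongr
        _ < c + (d + 1) • γ m + k • γ m := by gcongr
        _ = _ := by abel
    · right
      push Not at h
      exact Eventually.of_forall h
  have pair' : ∀ k l : ℕ, k ≠ l → ∀ b c : Γ,
      (∀ᶠ i in atTop, b + k • γ i < c + l • γ i) ∨
      (∀ᶠ i in atTop, c + l • γ i < b + k • γ i) := by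
    intro k l hkl b c
    rcases lt_or_gt_of_ne hkl with h | h
    · exact pair k l h b c
    · exact (pair l k h c b).symm
  induction S using Finset.induction_on with
  | empty => left; simp
  | insert m S hm ih =>
    by_cases hmt : β m = ⊤
    · rcases ih with ih | ⟨k₀, hk, hb, he⟩
      · left
        intro k hk
        rcases Finset.mem_insert.1 hk with rfl | hk
        · exact hmt
        · exact ih k hk
      · right
        refine ⟨k₀, Finset.mem_insert_of_mem hk, hb, ?_⟩
        filter_upwards [he] with i hi l hl hlk
        rcases Finset.mem_insert.1 hl with rfl | hl
        · rw [hmt, top_add]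
          exact lt_top_iff_ne_top.2 (WithTop.add_ne_top.2 ⟨hb, WithTop.coe_ne_top⟩)
        · exact hi l hl hlk
    · right
      rcases ih with ih | ⟨k₀, hk, hb, he⟩
      · refine ⟨m, Finset.mem_insert_self _ _, hmt, Eventually.of_forall ?_⟩
        intro i l hl hlk
        rcases Finset.mem_insert.1 hl with rfl | hl
        · exact absurd rfl hlk
        · rw [ih l hl, top_add]
          exact lt_top_iff_ne_top.2 (WithTop.add_ne_top.2 ⟨hmt, WithTop.coe_ne_top⟩)
      · have hne : k₀ ≠ m := by rintro rfl; exact hm hk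
        obtain ⟨b, hb'⟩ := WithTop.ne_top_iff_exists.1 hb
        obtain ⟨c, hc'⟩ := WithTop.ne_top_iff_exists.1 hmt
        rcases pair' k₀ m hne b c with h | h
        · refine ⟨k₀, Finset.mem_insert_of_mem hk, hb, ?_⟩
          filter_upwards [he, h] with i hi hi2 l hl hlk
          rcases Finset.mem_insert.1 hl with rfl | hl
          · rw [← hb', ← hc']; exact_mod_cast hi2
          · exact hi l hl hlk
        · refine ⟨m, Finset.mem_insert_self _ _, hmt, ?_⟩
          filter_upwards [he, h] with i hi hi2 l hl hlk
          have hi3 : β m + ((m • γ i : Γ) : WithTop Γ) < β k₀ + ((k₀ • γ i : Γ) : WithTop Γ) := by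
            rw [← hb', ← hc']; exact_mod_cast hi2
          rcases Finset.mem_insert.1 hl with rfl | hl
          · exact absurd rfl hlk
          · by_cases hlk0 : l = k₀
            · rw [hlk0]; exact hi3
            · exact hi3.trans (hi l hl hlk0)

theorem aux_val {K Γ : Type*} [Field K] [AddCommGroup Γ] [LinearOrder Γ] [IsOrderedAddMonoid Γ]
    (v : K → WithTop Γ) (hv : IsValdF v) : ∃ w : AddValuation K (WithTop Γ), ∀ x, w x = v x := by
  obtain ⟨h1, h2, h3⟩ := hv
  have h10 : v 1 = 0 := by
    have hne : v 1 ≠ ⊤ := fun h => one_ne_zero ((h3 1).1 h)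
    obtain ⟨c, hc⟩ := WithTop.ne_top_iff_exists.1 hne
    have := h1 1 1
    rw [mul_one, ← hc] at this
    have h' : c = c + c := by exact_mod_cast this
    rw [← hc]
    have : c = 0 := by simpa using h'
    rw [this]; rfl
  exact ⟨AddValuation.of v ((h3 0).2 rfl) h10 h2 h1, fun x => rfl⟩

open Filter in
theorem aux_core {K Γ : Type*} [Field K] [AddCommGroup Γ] [LinearOrder Γ] [IsOrderedAddMonoid Γ]
    (v : AddValuation K (WithTop Γ))
    {I : Type*} [LinearOrder I] [Nonempty I]
    (hnomax : ∀ i : I, ∃ j : I, i < j)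
    (a : I → K) (γ : I → Γ) (hmono : StrictMono γ)
    (hγ : ∀ i j : I, i < j → v (a j - a i) = (γ i : WithTop Γ))
    (f : Polynomial K) (hf : f.natDegree ≠ 0)
    (hlow : ∀ h : Polynomial K, h.degree < f.degree → PCFixed v a h) :
    ∃ k₀ : ℕ, k₀ ≠ 0 ∧ ∃ b : Γ, ∀ᶠ i in atTop,
      (∀ j, i < j → v (f.eval (a j) - f.eval (a i)) = ((b + k₀ • γ i : Γ) : WithTop Γ)) ∧
      mval v (a i) (γ i) f = min (v (f.eval (a i))) ((b + k₀ • γ i : Γ) : WithTop Γ) := by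
  have hfix : ∀ k : ℕ, ∃ β : WithTop Γ, k ≠ 0 →
      ∀ᶠ i in atTop, v ((Polynomial.taylor (a i) f).coeff k) = β := by
    intro k
    by_cases hk : k = 0
    · exact ⟨0, fun h => absurd hk h⟩
    have hd : (hasseDeriv k f).degree < f.degree := by
      apply degree_lt_degree
      have := natDegree_hasseDeriv_le f k
      omega
    obtain ⟨i₀, hi₀⟩ := hlow _ hd
    refine ⟨v ((hasseDeriv k f).eval (a i₀)), fun _ => ?_⟩
    filter_upwards [eventually_ge_atTop i₀] with i hi
    rw [taylor_coeff]
    exact hi₀ i hi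
  choose β hβ using hfix
  set S : Finset ℕ := (Finset.range (f.natDegree + 1)).erase 0 with hS
  have h0S : (0 : ℕ) ∈ Finset.range (f.natDegree + 1) := by simp
  have hβS : ∀ᶠ i in atTop, ∀ k ∈ S, v ((Polynomial.taylor (a i) f).coeff k) = β k := by
    rw [Filter.eventually_all_finset]
    intro k hk
    exact hβ k (Finset.ne_of_mem_erase hk)
  rcases aux_min hnomax γ hmono β S with htop | ⟨k₀, hk₀, hb, hmin⟩
  · exfalso
    have hnS : f.natDegree ∈ S := by simp [hS, hf]
    obtain ⟨i, hi⟩ := hβS.exists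
    have := hi _ hnS
    rw [htop _ hnS, AddValuation.top_iff] at this
    have h2 := natDegree_taylor f (a i)
    rw [← h2] at this
    have h3 : taylor (a i) f = 0 := leadingCoeff_eq_zero.1 this
    rw [h3] at h2
    simp at h2
    exact hf h2.symm
  · obtain ⟨b, hb'⟩ := WithTop.ne_top_iff_exists.1 hb
    refine ⟨k₀, Finset.ne_of_mem_erase hk₀, b, ?_⟩
    filter_upwards [hβS, hmin] with i hi hm
    have hδ : ((b + k₀ • γ i : Γ) : WithTop Γ) = β k₀ + ((k₀ • γ i : Γ) : WithTop Γ) := by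
      rw [← hb']; rfl
    constructor
    · intro j hj
      have e1 : f.eval (a j) - f.eval (a i) =
          ∑ k ∈ S, (taylor (a i) f).coeff k * (a j - a i) ^ k := by
        have : f.eval (a j) = (taylor (a i) f).eval (a j - a i) := by
          rw [taylor_eval]; congr 1; ring
        rw [this, eval_eq_sum_range, natDegree_taylor, ← Finset.add_sum_erase _ _ h0S]
        simp [hS]
      have hterm : ∀ k ∈ S, v ((taylor (a i) f).coeff k * (a j - a i) ^ k) =
          β k + ((k • γ i : Γ) : WithTop Γ) := by
        intro k hk
        rw [AddValuation.map_mul, hi k hk, AddValuation.map_pow, hγ i j hj]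
        rfl
      rw [e1, ← Finset.add_sum_erase _ _ hk₀, hδ, ← hterm k₀ hk₀]
      apply AddValuation.map_add_eq_of_lt_left
      apply AddValuation.map_lt_sum
      · rw [hterm k₀ hk₀, ← hδ]; exact WithTop.coe_ne_top
      · intro l hl
        rw [hterm k₀ hk₀, hterm l (Finset.mem_of_mem_erase hl)]
        exact hm l (Finset.mem_of_mem_erase hl) (Finset.ne_of_mem_erase hl)
    · unfold mval
      rw [← Finset.insert_erase h0S, Finset.inf_insert, ← hS]
      congr 1
      · simp [taylor_coeff_zero]
      · rw [hδ]
        apply le_antisymm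
        · refine (Finset.inf_le hk₀).trans ?_
          rw [hi k₀ hk₀]
        · apply Finset.le_inf
          intro l hl
          rw [hi l hl]
          by_cases hlk : l = k₀
          · rw [hlk]
          · exact (hm l hl hlk).le

open Filter in
theorem aux_key {K Γ : Type*} [Field K] [AddCommGroup Γ] [LinearOrder Γ] [IsOrderedAddMonoid Γ]
    (v : AddValuation K (WithTop Γ))
    {I : Type*} [LinearOrder I] [Nonempty I]
    (hnomax : ∀ i : I, ∃ j : I, i < j)
    (a : I → K) (γ : I → Γ) (hmono : StrictMono γ)
    (hγ : ∀ i j : I, i < j → v (a j - a i) = (γ i : WithTop Γ))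
    (f : Polynomial K)
    (hlow : ∀ h : Polynomial K, h.degree < f.degree → PCFixed v a h) :
    FamStable (fun i : I => mval v (a i) (γ i)) f ↔ PCFixed v a f := by
  by_cases hf : f.natDegree = 0
  · rw [natDegree_eq_zero] at hf
    obtain ⟨c, rfl⟩ := hf
    have i₀ : I := Classical.arbitrary I
    constructor
    · intro _
      exact ⟨i₀, fun i _ => by simp⟩
    · intro _
      exact ⟨i₀, fun i _ => by simp [mval]⟩
  obtain ⟨k₀, hk, b, hev⟩ := aux_core v hnomax a γ hmono hγ f hf hlow
  obtain ⟨i₀, H⟩ := eventually_atTop.1 hev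
  set δ : I → WithTop Γ := fun i => ((b + k₀ • γ i : Γ) : WithTop Γ) with hδ
  have hδm : StrictMono δ := by
    intro i j hij
    have : b + k₀ • γ i < b + k₀ • γ j := by
      have := nsmul_lt_nsmul_right hk (hmono hij)
      gcongr
    exact WithTop.coe_lt_coe.2 this
  have Hd : ∀ i, i₀ ≤ i → ∀ j, i < j → v (f.eval (a j) - f.eval (a i)) = δ i :=
    fun i hi => (H i hi).1
  have Hm : ∀ i, i₀ ≤ i → mval v (a i) (γ i) f = min (v (f.eval (a i))) (δ i) :=
    fun i hi => (H i hi).2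
  -- small value
  have small : ∀ i, i₀ ≤ i → v (f.eval (a i)) < δ i → ∀ j, i < j →
      v (f.eval (a j)) = v (f.eval (a i)) := by
    intro i hi hlt j hj
    have e : f.eval (a j) = f.eval (a i) + (f.eval (a j) - f.eval (a i)) := by ring
    rw [e]
    apply AddValuation.map_add_eq_of_lt_left
    rwa [Hd i hi j hj]
  have large : ∀ i, i₀ ≤ i → δ i < v (f.eval (a i)) → ∀ j, i < j →
      v (f.eval (a j)) = δ i := by
    intro i hi hlt j hj
    have e : f.eval (a j) = (f.eval (a j) - f.eval (a i)) + f.eval (a i) := by ring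
    rw [e, ← Hd i hi j hj]
    apply AddValuation.map_add_eq_of_lt_left
    rwa [Hd i hi j hj]
  constructor
  · rintro ⟨i₁, hs⟩
    by_contra hnf
    have heq : ∀ i, i₀ ≤ i → v (f.eval (a i)) = δ i := by
      intro i hi
      rcases lt_trichotomy (v (f.eval (a i))) (δ i) with h | h | h
      · exfalso; apply hnf
        refine ⟨i, fun j hj => ?_⟩
        rcases hj.eq_or_lt with rfl | hj
        · rfl
        · exact small i hi h j hj
      · exact h
      · exfalso; apply hnf
        obtain ⟨m, hm⟩ := hnomax i
        refine ⟨m, fun j hj => ?_⟩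
        rw [large i hi h j (hm.trans_le hj), large i hi h m hm]
    obtain ⟨m, hm⟩ := hnomax (max i₀ i₁)
    have h0 : i₀ ≤ max i₀ i₁ := le_max_left _ _
    have e1 := hs (max i₀ i₁) (le_max_right _ _)
    have e2 := hs m ((le_max_right _ _).trans hm.le)
    have e3 := e2.trans e1.symm
    simp only [] at e3
    rw [Hm _ h0, Hm _ (h0.trans hm.le), heq _ h0, heq _ (h0.trans hm.le), min_self, min_self] at e3
    exact (hδm hm).ne' e3
  · rintro ⟨i₁, hs⟩
    -- eventually small
    obtain ⟨m, hm⟩ := hnomax (max i₀ i₁)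
    have hm0 : i₀ ≤ m := (le_max_left _ _).trans hm.le
    have hm1 : i₁ ≤ m := (le_max_right _ _).trans hm.le
    have hsm : v (f.eval (a m)) < δ m := by
      by_contra hcon
      push Not at hcon
      have h0 : i₀ ≤ max i₀ i₁ := le_max_left _ _
      have ec : v (f.eval (a m)) = v (f.eval (a (max i₀ i₁))) := by
        rw [hs m hm1, hs _ (le_max_right _ _)]
      have hlt : δ (max i₀ i₁) < v (f.eval (a (max i₀ i₁))) := by
        rw [← ec]; exact (hδm hm).trans_le hcon
      have := large _ h0 hlt m hm
      rw [ec] at this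
      exact hlt.ne' this
    refine ⟨m, fun j hj => ?_⟩
    have ej : v (f.eval (a j)) = v (f.eval (a m)) := by
      rw [hs m hm1, hs j (hm1.trans hj)]
    simp only []
    rw [Hm m hm0, Hm j (hm0.trans hj), ej, min_eq_left hsm.le,
      min_eq_left (hsm.le.trans (hδm.monotone hj))]

/-- a nonzero polynomial has minimal degree among `𝔳`-unstable polynomials
(for the family `ν_i = v_{a_i,γ_i}`) if and only if it has minimal degree among the
polynomials not fixed by the pseudo-Cauchy sequence `{a_i}`. -/
theorem stmt15 {K Γ : Type*} [Field K] [AddCommGroup Γ] [LinearOrder Γ] [IsOrderedAddMonoid Γ]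
    (v : K → WithTop Γ) (hv : IsValdF v)
    {I : Type*} [LinearOrder I] [WellFoundedLT I] [Nonempty I]
    (hnomax : ∀ i : I, ∃ j : I, i < j)
    (a : I → K)
    (hpc : ∀ i j k : I, i < j → j < k → v (a i - a j) < v (a j - a k))
    (γ : I → Γ) (hγ : ∀ i j : I, i < j → v (a j - a i) = (γ i : WithTop Γ)) :
    ∀ f : Polynomial K, f ≠ 0 →
      ((¬ FamStable (fun i : I => mval v (a i) (γ i)) f ∧
          ∀ h : Polynomial K, h.degree < f.degree →
            FamStable (fun i : I => mval v (a i) (γ i)) h) ↔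
        (¬ PCFixed v a f ∧
          ∀ h : Polynomial K, h.degree < f.degree → PCFixed v a h)) := by
  obtain ⟨w, hw⟩ := aux_val v hv
  have hwv : v = (w : K → WithTop Γ) := funext fun x => (hw x).symm
  subst hwv
  have hmono : StrictMono γ := by
    intro i j hij
    obtain ⟨k, hk⟩ := hnomax j
    have := hpc i j k hij hk
    rw [AddValuation.map_sub_swap, hγ i j hij, AddValuation.map_sub_swap, hγ j k hk] at this
    exact WithTop.coe_lt_coe.1 this
  have key := aux_key w hnomax a γ hmono hγ
  intro f _
  constructor
  · rintro ⟨h1, h2⟩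
    have hall : ∀ n : WithBot ℕ, ∀ h : Polynomial K, h.degree = n → h.degree < f.degree →
        PCFixed w a h := by
      intro n
      induction n using WellFoundedLT.induction with
      | ind n ih =>
        intro h hn hd
        refine (key h fun g hg => ih g.degree (hn ▸ hg) g rfl (hg.trans hd)).1 (h2 h hd)
    have hall' : ∀ h : Polynomial K, h.degree < f.degree → PCFixed w a h :=
      fun h hd => hall _ h rfl hd
    exact ⟨fun hfx => h1 ((key f hall').2 hfx), hall'⟩
  · rintro ⟨h1, h2⟩
    exact ⟨fun hs => h1 ((key f h2).1 hs),
      fun h hd => (key h fun g hg => h2 g (hg.trans hd)).2 (h2 h hd)⟩
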